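/- Let (U_k) be an MP-sequence and let k ≥ 1 and i satisfy 0 ≤ 2i ≤ k−1. Then U_{k−2i}/U_{k−2i−1} ≤ P_{2j+2}/P_{2j+1} if and only if U_{k+1}/U_k ≥ P_{2(j+i)+3}/P_{2(j+i)+2}. -/

import Mathlib

def IsMPSeq (U : ℕ → ℕ) : Prop :=
  (∀ k, 0 < U k) ∧ U 1 ≤ U 0 ∧ ∀ k, U (k + 2) = U (k + 1) + U k

/-- The cross-multiplied comparison of consecutive ratios of two sequences satisfying the Fibonacci
recurrence is unchanged when both are shifted by an even number of steps. -/
theorem mul_le_mul_add_two_mul_iff {U V : ℕ → ℕ} (hU : ∀ k, U (k + 2) = U (k + 1) + U k)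
    (hV : ∀ k, V (k + 2) = V (k + 1) + V k) (m n i : ℕ) :
    V (n + 2 * i + 1) * U (m + 2 * i) ≤ U (m + 2 * i + 1) * V (n + 2 * i) ↔
      V (n + 1) * U m ≤ U (m + 1) * V n := by
  induction i with
  | zero => rfl
  | succ i ih =>
    rw [← ih, show m + 2 * (i + 1) = m + 2 * i + 2 by ring,
      show n + 2 * (i + 1) = n + 2 * i + 2 by ring, hU (m + 2 * i + 1), hU (m + 2 * i),
      hV (n + 2 * i + 1), hV (n + 2 * i)]
    constructor <;> intro h <;> nlinarith

theorem mp_ratio_iff_odd (U : ℕ → ℕ) (hU : IsMPSeq U) (k i j : ℕ)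
    (hk : 1 ≤ k) (hi : 2 * i ≤ k - 1) :
    (U (k - 2 * i) : ℝ) / (U (k - 2 * i - 1) : ℝ) ≤
        (Nat.fib (2 * j + 2) : ℝ) / (Nat.fib (2 * j + 1) : ℝ) ↔
      (U (k + 1) : ℝ) / (U k : ℝ) ≥
        (Nat.fib (2 * (j + i) + 3) : ℝ) / (Nat.fib (2 * (j + i) + 2) : ℝ) := by
  obtain ⟨hpos, -, hrec⟩ := hU
  obtain ⟨m, rfl⟩ : ∃ m, k = m + 1 + 2 * i := ⟨k - 1 - 2 * i, by omega⟩
  have hfib (n : ℕ) : Nat.fib (n + 2) = Nat.fib (n + 1) + Nat.fib n := by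
    rw [Nat.fib_add_two, add_comm]
  have hU_pos (n : ℕ) : (0 : ℝ) < U n := by exact_mod_cast hpos n
  have hF_pos (n : ℕ) : (0 : ℝ) < Nat.fib (n + 1) := by
    exact_mod_cast Nat.fib_pos.2 n.succ_pos
  rw [Nat.add_sub_cancel, Nat.add_sub_cancel, ge_iff_le,
    div_le_div_iff₀ (hU_pos _) (hF_pos _), div_le_div_iff₀ (hF_pos _) (hU_pos _),
    show 2 * (j + i) + 3 = 2 * j + 2 + 2 * i + 1 by ring,
    show 2 * (j + i) + 2 = 2 * j + 2 + 2 * i by ring]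
  norm_cast
  rw [mul_le_mul_add_two_mul_iff hrec hfib, hrec m, hfib (2 * j + 1)]
  constructor <;> intro h <;> nlinarith
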